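/- For every integer n ≥ 0, the number of lattice paths of length 2n+1 that stay in the strip [-2, 1] and end at height 1 equals the Fibonacci number F(2n+1). -/

import Mathlib

/-- The height of a lattice path `s : Fin n → ℤ` after `j` steps:
the sum of the first `j` steps. -/
def pathHeight {n : ℕ} (s : Fin n → ℤ) (j : ℕ) : ℤ :=
  ∑ i ∈ Finset.univ.filter (fun i : Fin n => (i : ℕ) < j), s i

/-- The number of lattice paths of length `n` (steps `±1`) whose height stays in
`[a, b]` at every time `0 ≤ j ≤ n` and whose final height lies in `E`. -/
noncomputable def pathCount (n : ℕ) (a b : ℤ) (E : Set ℤ) : ℕ :=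
  Nat.card {s : Fin n → ℤ //
    (∀ i, s i ∈ ({1, -1} : Set ℤ)) ∧
    (∀ j ≤ n, pathHeight s j ∈ Set.Icc a b) ∧
    pathHeight s n ∈ E}

theorem pathHeight_snoc_of_le {n : ℕ} (s : Fin n → ℤ) (x : ℤ) {j : ℕ} (hj : j ≤ n) :
    pathHeight (Fin.snoc s x : Fin (n + 1) → ℤ) j = pathHeight s j := by
  simp [pathHeight, Finset.sum_filter, Fin.sum_univ_castSucc, hj.not_gt]

theorem pathHeight_snoc_succ {n : ℕ} (s : Fin n → ℤ) (x : ℤ) :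
    pathHeight (Fin.snoc s x : Fin (n + 1) → ℤ) (n + 1) = pathHeight s n + x := by
  simp [pathHeight, Finset.sum_filter, Fin.sum_univ_castSucc]

/-- The lattice paths of length `n` that stay in `[a, b]` and end at height `m`. -/
def stripPaths (n : ℕ) (a b m : ℤ) : Set (Fin n → ℤ) :=
  {s | (∀ i, s i ∈ ({1, -1} : Set ℤ)) ∧
    (∀ j ≤ n, pathHeight s j ∈ Set.Icc a b) ∧ pathHeight s n ∈ ({m} : Set ℤ)}

theorem pathCount_singleton (n : ℕ) (a b m : ℤ) :
    pathCount n a b {m} = (stripPaths n a b m).ncard := rfl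

theorem stripPaths_finite (n : ℕ) (a b m : ℤ) : (stripPaths n a b m).Finite :=
  (Set.Finite.pi' (t := fun _ : Fin n => ({1, -1} : Set ℤ)) fun _ => Set.toFinite _).subset
    fun _ hs => hs.1

theorem snoc_mem_stripPaths {n : ℕ} {a b m x : ℤ} {s : Fin n → ℤ} (hm : m ∈ Set.Icc a b) :
    (Fin.snoc s x : Fin (n + 1) → ℤ) ∈ stripPaths (n + 1) a b m ↔
      (x = 1 ∨ x = -1) ∧ s ∈ stripPaths n a b (m - x) := by
  have hsteps : (∀ i, (Fin.snoc s x : Fin (n + 1) → ℤ) i ∈ ({1, -1} : Set ℤ)) ↔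
      (∀ i, s i ∈ ({1, -1} : Set ℤ)) ∧ (x = 1 ∨ x = -1) := by
    simp [Fin.forall_fin_succ']
  simp only [stripPaths, Set.mem_ofPred_eq, hsteps, pathHeight_snoc_succ, Set.mem_singleton_iff]
  constructor
  · rintro ⟨⟨hs, hx⟩, hb, he⟩
    refine ⟨hx, hs, fun j hj => ?_, by linarith⟩
    rw [← pathHeight_snoc_of_le s x hj]
    exact hb j (by omega)
  · rintro ⟨hx, hs, hb, he⟩
    refine ⟨⟨hs, hx⟩, fun j hj => ?_, by linarith⟩
    rcases Nat.le_succ_iff.mp hj with hj | rfl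
    · rw [pathHeight_snoc_of_le s x hj]
      exact hb j hj
    · rwa [pathHeight_snoc_succ, he, sub_add_cancel]

theorem pathCount_succ (n : ℕ) {a b m : ℤ} (hm : m ∈ Set.Icc a b) :
    pathCount (n + 1) a b {m} = pathCount n a b {m - 1} + pathCount n a b {m + 1} := by
  have hinj (x : ℤ) : Function.Injective fun s : Fin n → ℤ => (Fin.snoc s x : Fin (n + 1) → ℤ) :=
    fun s t h => (Fin.snoc_inj.mp h).1
  have hunion : stripPaths (n + 1) a b m =
      (fun s => (Fin.snoc s (1 : ℤ) : Fin (n + 1) → ℤ)) '' stripPaths n a b (m - 1) ∪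
      (fun s => (Fin.snoc s (-1 : ℤ) : Fin (n + 1) → ℤ)) '' stripPaths n a b (m + 1) := by
    ext s
    induction s using Fin.snocCases with
    | snoc s x =>
      rw [snoc_mem_stripPaths hm]
      simp only [Set.mem_union, Set.mem_image, Fin.snoc_inj]
      constructor
      · rintro ⟨rfl | rfl, hs⟩
        · exact .inl ⟨s, hs, rfl, rfl⟩
        · exact .inr ⟨s, by simpa using hs, rfl, rfl⟩
      · rintro (⟨s, hs, rfl, rfl⟩ | ⟨s, hs, rfl, rfl⟩)
        · exact ⟨.inl rfl, hs⟩
        · exact ⟨.inr rfl, by simpa using hs⟩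
  simp only [pathCount_singleton]
  rw [hunion, Set.ncard_union_eq ?_ ((stripPaths_finite ..).image _) ((stripPaths_finite ..).image _),
    Set.ncard_image_of_injective _ (hinj 1), Set.ncard_image_of_injective _ (hinj (-1))]
  rw [Set.disjoint_left]
  rintro _ ⟨s, -, rfl⟩ ⟨t, -, h⟩
  have := (Fin.snoc_inj.mp h).2
  omega

theorem pathCount_eq_zero (n : ℕ) {a b m : ℤ} (hm : m ∉ Set.Icc a b) :
    pathCount n a b {m} = 0 := by
  rw [pathCount_singleton, Set.ncard_eq_zero (stripPaths_finite ..), Set.eq_empty_iff_forall_notMem]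
  rintro s ⟨-, hb, he⟩
  exact hm (he ▸ hb n le_rfl)

theorem pathCount_zero {a b : ℤ} (h : 0 ∈ Set.Icc a b) (m : ℤ) :
    pathCount 0 a b {m} = if m = 0 then 1 else 0 := by
  have hset : stripPaths 0 a b m = if m = 0 then Set.univ else ∅ := by
    ext s
    split_ifs with hm <;> simp_all [stripPaths, pathHeight, eq_comm]
  rw [pathCount_singleton, hset]
  split_ifs <;> simp

theorem pathCount_odd (n : ℕ) :
    pathCount (2 * n + 1) (-2) 1 {1} = pathCount (2 * n) (-2) 1 {0} ∧
    pathCount (2 * n + 1) (-2) 1 {-1} =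
      pathCount (2 * n) (-2) 1 {-2} + pathCount (2 * n) (-2) 1 {0} := by
  rw [pathCount_succ (m := 1) _ (by simp), pathCount_succ (m := -1) _ (by simp)]
  norm_num
  exact pathCount_eq_zero _ (by simp)

theorem pathCount_even (n : ℕ) :
    pathCount (2 * n) (-2) 1 {-2} = Nat.fib (2 * n) ∧
    pathCount (2 * n) (-2) 1 {0} = Nat.fib (2 * n + 1) := by
  induction n with
  | zero => simp [pathCount_zero]
  | succ n ih =>
    obtain ⟨h1, h2⟩ := pathCount_odd n
    rw [ih.2] at h1
    rw [ih.1, ih.2, ← Nat.fib_add_two] at h2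
    have h3 : pathCount (2 * n + 1) (-2) 1 {-3} = 0 := pathCount_eq_zero _ (by simp)
    rw [show 2 * (n + 1) = 2 * n + 1 + 1 by ring, pathCount_succ (m := -2) _ (by simp),
      pathCount_succ (m := 0) _ (by simp), Nat.fib_add_two (n := 2 * n + 1)]
    norm_num
    rw [h1, h2, h3]
    exact ⟨zero_add _, add_comm _ _⟩

theorem stmt_16 (n : ℕ) :
    pathCount (2 * n + 1) (-2) 1 ({1} : Set ℤ) = Nat.fib (2 * n + 1) := by
  rw [(pathCount_odd n).1, (pathCount_even n).2]
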